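/- Let q ≥ 2 and a > 0 be real numbers and let 0 < w < 1. Suppose g and h are analytic on a disc {u ∈ ℂ : |u| < ρ} for some ρ > q^{−a}, that f(u) = Σ_{n≥0} a_n u^n (a_n ∈ ℂ) converges for |u| < q^{−a}, and that f(u) = g(u)·(q^{−a} − u)^{−w} + h(u) for all |u| < q^{−a}, where z^{−w} denotes the principal complex power. Then, as n → ∞, a_n = c₁·q^{an}·n^{w−1} + c₂·q^{an}·n^{w−2} + O(q^{an}·n^{w−3}), where c₁ = g(q^{−a})·q^{aw}/Γ(w) and c₂ = (q^{aw}/Γ(w−1))·((w/2)·g(q^{−a}) − q^{−a}·g′(q^{−a})). -/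

import Mathlib

open Filter Asymptotics Topology

lemma aux_log (x : ℝ) (h0 : 0 ≤ x) (h1 : x ≤ 1/2) : |Real.log (1 + x) - x + x^2/2| ≤ 2 * x^3 := by
  have h := Real.abs_log_sub_add_sum_range_le (x := -x) (by rw [abs_neg, abs_of_nonneg h0]; linarith) 2
  simp only [Finset.sum_range_succ, Finset.sum_range_zero, abs_neg, abs_of_nonneg h0] at h
  have e : Real.log (1 + x) - x + x^2/2 = (0 + (-x) ^ (0 + 1) / ((0:ℕ) + 1 : ℝ) + (-x) ^ (1 + 1) / ((1:ℕ) + 1 : ℝ) + Real.log (1 - -x)) := by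
    rw [sub_neg_eq_add]; push_cast; ring
  rw [e]
  refine h.trans ?_
  rw [div_le_iff₀ (by linarith)]
  have : 0 ≤ x^3 := by positivity
  norm_num
  nlinarith

lemma aux_tele (C : ℝ) (hC : 0 ≤ C) (e : ℕ → ℝ) (N : ℕ) (hN : 1 ≤ N)
    (he : ∀ n, N ≤ n → |e (n+1) - e n| ≤ C / (n:ℝ)^3) (ht : Tendsto e atTop (𝓝 0)) :
    ∀ n, N ≤ n → |e n| ≤ 2 * C / (n:ℝ)^2 := by
  have key : ∀ e : ℕ → ℝ, (∀ n, N ≤ n → |e (n+1) - e n| ≤ C / (n:ℝ)^3) → Tendsto e atTop (𝓝 0) →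
      ∀ n, N ≤ n → e n ≤ 2 * C / (n:ℝ)^2 := by
    intro e he ht n hn
    have hp : ∀ m, N ≤ m → e m - 2 * C / (m:ℝ)^2 ≤ e (m+1) - 2 * C / ((m+1 : ℕ):ℝ)^2 := by
      intro m hm
      have h1 := (abs_le.1 (he m hm)).1
      have hm0 : (1:ℝ) ≤ m := by exact_mod_cast hN.trans hm
      have : C / (m:ℝ)^3 ≤ 2 * C / (m:ℝ)^2 - 2 * C / ((m+1 : ℕ):ℝ)^2 := by
        have : 2 * C / (m:ℝ)^2 - 2 * C / ((m+1 : ℕ):ℝ)^2 - C / (m:ℝ)^3 = C * (2 * m * (2*m+1) - (m+1)^2) / ((m:ℝ)^3 * (m+1)^2) := by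
          push_cast
          field_simp
          ring
        have h2 : 0 ≤ C * (2 * m * (2*m+1) - (m+1)^2) / ((m:ℝ)^3 * (m+1)^2) := by
          have : (0:ℝ) ≤ 2 * m * (2*m+1) - (m+1)^2 := by nlinarith
          positivity
        linarith
      linarith
    have hmono : Monotone (fun k : ℕ => e (n + k) - 2 * C / ((n + k : ℕ):ℝ)^2) :=
      monotone_nat_of_le_succ (fun k => by have := hp (n+k) (by omega); simpa [add_assoc] using this)
    have hlim : Tendsto (fun k : ℕ => e (n + k) - 2 * C / ((n + k : ℕ):ℝ)^2) atTop (𝓝 0) := by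
      have h1 : Tendsto (fun k : ℕ => 2 * C / ((k : ℕ):ℝ)^2) atTop (𝓝 0) :=
        Tendsto.const_div_atTop ((tendsto_pow_atTop two_ne_zero).comp tendsto_natCast_atTop_atTop) _
      have h2 : Tendsto (fun k : ℕ => e k - 2 * C / ((k : ℕ):ℝ)^2) atTop (𝓝 0) := by simpa using ht.sub h1
      have h3 : Tendsto (fun k : ℕ => n + k) atTop atTop := tendsto_atTop_mono (fun k => Nat.le_add_left k n) tendsto_id
      exact h2.comp h3
    have := hmono.ge_of_tendsto hlim 0
    simp at this
    linarith
  intro n hn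
  rw [abs_le]
  have h1 := key e he ht n hn
  have h2 := key (fun n => - e n) (fun n hn => by
    have := he n hn
    rw [← abs_neg] at this
    convert this using 2; ring) (by simpa using ht.neg) n hn
  constructor <;> linarith

noncomputable def cr (s : ℝ) (n : ℕ) : ℝ := ∏ i ∈ Finset.range n, (s + i) / (i + 1)
noncomputable def cc (s : ℂ) (n : ℕ) : ℂ := ∏ i ∈ Finset.range n, (s + i) / (i + 1)

lemma cc_ofReal (s : ℝ) (n : ℕ) : cc s n = (cr s n : ℂ) := by unfold cc cr; push_cast; rfl

lemma cr_succ (s : ℝ) (n : ℕ) : cr s (n+1) = cr s n * ((s + n) / (n + 1)) := by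
  unfold cr; rw [Finset.prod_range_succ]

lemma cr_pos (s : ℝ) (hs : 0 < s) (n : ℕ) : 0 < cr s n := by
  unfold cr
  exact Finset.prod_pos (fun i _ => by positivity)

lemma cr_shift (s : ℝ) (n : ℕ) : cr (s-1) n * (s - 1 + n) = (s-1) * cr s n := by
  induction n with
  | zero => simp [cr]
  | succ n ih =>
    rw [cr_succ, cr_succ]
    have : (n:ℝ) + 1 ≠ 0 := by positivity
    calc _ = cr (s-1) n * (s - 1 + n) * ((s - 1 + (n+1:ℕ)) / (n+1)) := by ring
      _ = _ := by rw [ih]; push_cast; ring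

lemma cr_fact (s : ℝ) (n : ℕ) : cr s n * n.factorial = ∏ i ∈ Finset.range n, (s + i) := by
  induction n with
  | zero => simp [cr]
  | succ n ih =>
    rw [cr_succ, Finset.prod_range_succ, ← ih, Nat.factorial_succ]
    push_cast
    field_simp

noncomputable def dd (w : ℝ) (n : ℕ) : ℝ := cr w n * Real.Gamma w * (n:ℝ)^(1-w)

lemma dd_tendsto (w : ℝ) (hw : 0 < w) : Tendsto (dd w) atTop (𝓝 1) := by
  have hG := Real.GammaSeq_tendsto_Gamma w
  have hne : Real.Gamma w ≠ 0 := (Real.Gamma_pos_of_pos hw).ne'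
  have h1 : Tendsto (fun n : ℕ => (n:ℝ) / (n + w)) atTop (𝓝 1) := tendsto_natCast_div_add_atTop w
  have h2 : Tendsto (fun n : ℕ => (n:ℝ) / (n + w) * (Real.Gamma w / Real.GammaSeq w n)) atTop (𝓝 1) := by
    simpa [hne] using h1.mul ((tendsto_const_nhds (x := Real.Gamma w)).div hG hne)
  refine h2.congr' ?_
  filter_upwards [eventually_ge_atTop 1] with n hn
  have hn0 : (0:ℝ) < n := by exact_mod_cast hn
  have hc := cr_pos w hw n
  rw [Real.GammaSeq, Finset.prod_range_succ, ← cr_fact, dd, Real.rpow_sub hn0, Real.rpow_one]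
  have : (0:ℝ) < n.factorial := by positivity
  have h3 : 0 < (n:ℝ)^w := by positivity
  have h4 : (n:ℝ) + w ≠ 0 := by positivity
  have h5 : w + (n:ℝ) ≠ 0 := by positivity
  field_simp
  ring

lemma dd_log (w : ℝ) (hw : 0 < w) (hw1 : w < 1) :
    ∀ n : ℕ, 2 ≤ n → |Real.log (dd w n) + w * (1-w) / (2 * n)| ≤ 10 / (n:ℝ)^2 := by
  have hG := Real.Gamma_pos_of_pos hw
  have hlt : Tendsto (fun n => Real.log (dd w n)) atTop (𝓝 0) := by
    have := (Real.continuousAt_log one_ne_zero).tendsto.comp (dd_tendsto w hw)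
    rw [Real.log_one] at this
    exact this
  have h2 : Tendsto (fun n : ℕ => w * (1-w) / (2 * (n:ℝ))) atTop (𝓝 0) :=
    Tendsto.const_div_atTop (tendsto_natCast_atTop_atTop.const_mul_atTop (by norm_num)) _
  have := aux_tele 5 (by norm_num) (fun n => Real.log (dd w n) + w * (1-w) / (2 * n)) 2 (by norm_num) ?_ (by simpa using hlt.add h2)
  · intro n hn
    refine (this n hn).trans (le_of_eq (by norm_num))
  intro n hn
  have hn2 : (2:ℝ) ≤ n := by exact_mod_cast hn
  have hn0 : (0:ℝ) < n := by linarith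
  have hlog : ∀ m : ℕ, 0 < m → Real.log (dd w m) = Real.log (cr w m) + Real.log (Real.Gamma w) + (1-w) * Real.log m := by
    intro m hm
    have hm0 : (0:ℝ) < m := by exact_mod_cast hm
    have := cr_pos w hw m
    rw [dd, Real.log_mul (by positivity) (by positivity), Real.log_mul (by positivity) (by positivity), Real.log_rpow hm0]
  have hx : Real.log (1 + w / n) = Real.log (w + n) - Real.log n := by
    rw [← Real.log_div (by positivity) (by positivity)]; congr 1; field_simp; ring
  have hy : Real.log (1 + 1 / n) = Real.log (n + 1) - Real.log n := by
    rw [← Real.log_div (by positivity) (by positivity)]; congr 1; field_simp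
  have hcr := cr_pos w hw n
  have hd : Real.log (dd w (n+1)) - Real.log (dd w n) = Real.log (1 + w/n) - w * Real.log (1 + 1/n) := by
    rw [hlog _ (by omega), hlog _ (by omega), cr_succ, Real.log_mul (by positivity) (by positivity),
      Real.log_div (by positivity) (by positivity), hx, hy]
    push_cast; ring
  have b1 := aux_log (w/n) (by positivity) (by rw [div_le_iff₀ hn0]; linarith)
  have b2 := aux_log (1/n) (by positivity) (by rw [div_le_iff₀ hn0]; linarith)
  set X := Real.log (1 + w/n) with hX
  set Y := Real.log (1 + 1/n) with hY
  have e : Real.log (dd w (n+1)) + w * (1-w) / (2 * (n+1:ℕ)) - (Real.log (dd w n) + w * (1-w) / (2 * n))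
    = (X - w/n + (w/n)^2/2) - w * (Y - 1/n + (1/n)^2/2) + w * (1-w) / 2 * (1 / ((n:ℝ)^2 * (n+1))) := by
    have : Real.log (dd w (n+1)) = Real.log (dd w n) + (X - w * Y) := by linarith
    rw [this]; push_cast
    field_simp
    ring
  rw [e]
  have t0 : (w/n)^3 ≤ 1 / (n:ℝ)^3 := by
    rw [div_pow]; gcongr; exact pow_le_one₀ hw.le hw1.le
  have t1 : (1/n : ℝ)^3 = 1 / (n:ℝ)^3 := by simp
  have t2 : |w * (1-w) / 2 * (1 / ((n:ℝ)^2 * (n+1)))| ≤ 1 / (n:ℝ)^3 := by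
    rw [abs_of_nonneg (by have : 0 < 1 - w := by linarith
                          positivity)]
    have : 1 / ((n:ℝ)^2 * (n+1)) ≤ 1 / (n:ℝ)^3 := by
      apply one_div_le_one_div_of_le (by positivity); nlinarith [sq_nonneg (n:ℝ)]
    have h3 : w * (1-w) / 2 ≤ 1 := by nlinarith
    calc _ ≤ 1 * (1 / ((n:ℝ)^2 * (n+1))) := by gcongr
      _ ≤ _ := by linarith
  have t3 : |w * (Y - 1/n + (1/n)^2/2)| ≤ 2 * (1 / (n:ℝ)^3) := by
    rw [abs_mul, abs_of_pos hw, ← t1]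
    calc _ ≤ 1 * |(Y - 1/n + (1/n)^2/2)| := by gcongr
      _ ≤ _ := by linarith
  calc _ ≤ |(X - w/n + (w/n)^2/2) - w * (Y - 1/n + (1/n)^2/2)| + |w * (1-w) / 2 * (1 / ((n:ℝ)^2 * (n+1)))| := abs_add_le _ _
    _ ≤ |(X - w/n + (w/n)^2/2)| + |w * (Y - 1/n + (1/n)^2/2)| + 1 / (n:ℝ)^3 := by
      gcongr; exact abs_sub _ _
    _ ≤ 2 * (1 / (n:ℝ)^3) + 2 * (1 / (n:ℝ)^3) + 1 / (n:ℝ)^3 := by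
      gcongr; linarith
    _ = _ := by ring

lemma dd_asymp (w : ℝ) (hw : 0 < w) (hw1 : w < 1) :
    (fun n : ℕ => dd w n - 1 - w * (w-1) / 2 / n) =O[atTop] (fun n : ℕ => 1 / (n:ℝ)^2) := by
  refine IsBigO.of_bound 1000 ?_
  filter_upwards [eventually_ge_atTop 20] with n hn
  have hn2 : (20:ℝ) ≤ n := by exact_mod_cast hn
  have hn0 : (0:ℝ) < n := by linarith
  have h := dd_log w hw hw1 n (by omega)
  have hdp : 0 < dd w n := by
    have := cr_pos w hw n
    have hG := Real.Gamma_pos_of_pos hw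
    unfold dd; positivity
  set l := Real.log (dd w n) with hl
  have hlb : |l| ≤ 2 / n := by
    have h1 : 10 / (n:ℝ)^2 ≤ 1 / n := by
      rw [div_le_div_iff₀ (by positivity) hn0]; nlinarith
    have h2 : w * (1-w) / (2 * n) ≤ 1 / n := by
      have : w * (1-w) ≤ 1 := by nlinarith
      rw [div_le_div_iff₀ (by positivity) hn0]; nlinarith
    have h3 : 0 ≤ w * (1-w) / (2 * n) := by
      have : 0 < 1 - w := by linarith
      positivity
    rw [abs_le] at h ⊢
    have : 2 / (n:ℝ) = 1/n + 1/n := by ring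
    constructor <;> linarith
  have hl1 : |l| ≤ 1 := hlb.trans (by rw [div_le_one hn0]; linarith)
  have he := Real.abs_exp_sub_one_sub_id_le hl1
  have hexp : Real.exp l = dd w n := Real.exp_log hdp
  rw [hexp] at he
  have hl2 : l^2 ≤ 4 / (n:ℝ)^2 := by
    rw [← sq_abs]
    calc |l|^2 ≤ (2/n)^2 := by gcongr
      _ = _ := by ring
  have e : dd w n - 1 - w * (w-1) / 2 / n = (dd w n - 1 - l) + (l + w * (1-w) / (2 * n)) := by
    field_simp; ring
  rw [e, Real.norm_eq_abs, Real.norm_of_nonneg (by positivity)]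
  calc _ ≤ |dd w n - 1 - l| + |l + w * (1-w) / (2 * n)| := abs_add_le _ _
    _ ≤ 4 / (n:ℝ)^2 + 10 / (n:ℝ)^2 := by linarith
    _ = 14 * (1 / (n:ℝ)^2) := by ring
    _ ≤ _ := by gcongr; norm_num

lemma cr_eq_dd (w : ℝ) (hw : 0 < w) (n : ℕ) (hn : 1 ≤ n) : cr w n = dd w n / Real.Gamma w * (n:ℝ)^(w-1) := by
  have hG := Real.Gamma_pos_of_pos hw
  have hn0 : (0:ℝ) < n := by exact_mod_cast hn
  have : (n:ℝ)^(1-w) * (n:ℝ)^(w-1) = 1 := by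
    rw [← Real.rpow_add hn0]; simp
  unfold dd
  calc cr w n = cr w n * ((n:ℝ)^(1-w) * (n:ℝ)^(w-1)) := by rw [this, mul_one]
    _ = _ := by field_simp

lemma pow1 (w : ℝ) (n : ℕ) (hn : 1 ≤ n) : (n:ℝ)^(w-2) = (n:ℝ)^(w-1) / n := by
  have hn0 : (0:ℝ) < n := by exact_mod_cast hn
  rw [show w - 2 = (w-1) - 1 by ring, Real.rpow_sub_one hn0.ne']

lemma pow2 (w : ℝ) (n : ℕ) (hn : 1 ≤ n) : (n:ℝ)^(w-3) = (n:ℝ)^(w-1) / (n:ℝ)^2 := by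
  have hn0 : (0:ℝ) < n := by exact_mod_cast hn
  rw [show w - 3 = (w-1) - 1 - 1 by ring, Real.rpow_sub_one hn0.ne', Real.rpow_sub_one hn0.ne']
  field_simp

lemma asym1 (w : ℝ) (hw : 0 < w) (hw1 : w < 1) :
    (fun n : ℕ => cr w n - 1 / Real.Gamma w * (n:ℝ)^(w-1) - w * (w-1) / 2 / Real.Gamma w * (n:ℝ)^(w-2))
      =O[atTop] (fun n : ℕ => (n:ℝ)^(w-3)) := by
  have h := ((isBigO_refl (fun n : ℕ => (n:ℝ)^(w-1)) atTop).mul (dd_asymp w hw hw1)).const_mul_left (1 / Real.Gamma w)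
  refine h.congr' ?_ ?_
  · filter_upwards [eventually_ge_atTop 1] with n hn
    rw [cr_eq_dd w hw n hn, pow1 w n hn]; ring
  · filter_upwards [eventually_ge_atTop 1] with n hn
    rw [pow2 w n hn]; ring

lemma dd_sub (w : ℝ) (hw : 0 < w) (hw1 : w < 1) :
    (fun n : ℕ => dd w n - 1) =O[atTop] (fun n : ℕ => 1 / (n:ℝ)) := by
  have h1 : (fun n : ℕ => 1 / (n:ℝ)^2) =O[atTop] (fun n : ℕ => 1 / (n:ℝ)) := by
    refine IsBigO.of_bound 1 ?_
    filter_upwards [eventually_ge_atTop 1] with n hn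
    have hn0 : (1:ℝ) ≤ n := by exact_mod_cast hn
    rw [Real.norm_of_nonneg (by positivity), Real.norm_of_nonneg (by positivity), one_mul]
    apply one_div_le_one_div_of_le (by positivity); nlinarith
  have h2 : (fun n : ℕ => w * (w-1) / 2 / (n:ℝ)) =O[atTop] (fun n : ℕ => 1 / (n:ℝ)) := by
    have := (isBigO_refl (fun n : ℕ => 1 / (n:ℝ)) atTop).const_mul_left (w * (w-1) / 2)
    refine this.congr_left (fun n => by ring)
  refine (((dd_asymp w hw hw1).trans h1).add h2).congr_left (fun n => by ring)

lemma inv_shift (c : ℝ) : (fun n : ℕ => 1 / (c + (n:ℝ))) =O[atTop] (fun n : ℕ => 1 / (n:ℝ)) := by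
  refine IsBigO.of_bound 2 ?_
  obtain ⟨N, hN⟩ := exists_nat_ge (2 * |c| + 1)
  filter_upwards [eventually_ge_atTop N] with n hn
  have h1 : (N:ℝ) ≤ n := by exact_mod_cast hn
  have h2 := neg_abs_le c
  have h3 := abs_nonneg c
  have hn0 : (0:ℝ) < n := by linarith
  have h4 : (n:ℝ)/2 ≤ c + n := by linarith
  rw [Real.norm_of_nonneg (by apply one_div_nonneg.2; linarith), Real.norm_of_nonneg (by positivity)]
  calc 1 / (c + (n:ℝ)) ≤ 1 / ((n:ℝ)/2) := one_div_le_one_div_of_le (by positivity) h4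
    _ = _ := by field_simp

lemma asym2 (w : ℝ) (hw : 0 < w) (hw1 : w < 1) :
    (fun n : ℕ => cr (w-1) n - (w-1) / Real.Gamma w * (n:ℝ)^(w-2))
      =O[atTop] (fun n : ℕ => (n:ℝ)^(w-3)) := by
  have hz : (fun n : ℕ => dd w n - 1 + (1-w) * (1 / (n:ℝ))) =O[atTop] (fun n : ℕ => 1 / (n:ℝ)) :=
    (dd_sub w hw hw1).add ((isBigO_refl (fun n : ℕ => 1 / (n:ℝ)) atTop).const_mul_left (1-w))
  have h := ((isBigO_refl (fun n : ℕ => (n:ℝ)^(w-1)) atTop).mul (hz.mul (inv_shift (w-1)))).const_mul_left ((w-1) / Real.Gamma w)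
  refine h.congr' ?_ ?_
  · filter_upwards [eventually_ge_atTop 2] with n hn
    have hn0 : (2:ℝ) ≤ n := by exact_mod_cast hn
    have hp : 0 < w - 1 + n := by linarith
    have hG := Real.Gamma_pos_of_pos hw
    have e : cr (w-1) n = (w-1) * cr w n / (w - 1 + n) := by
      rw [← cr_shift]; field_simp
    rw [e, cr_eq_dd w hw n (by omega), pow1 w n (by omega)]
    field_simp
    ring
  · filter_upwards [eventually_ge_atTop 1] with n hn
    rw [pow2 w n hn]; ring

lemma asym3 (w : ℝ) (hw : 0 < w) (hw1 : w < 1) :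
    (fun n : ℕ => cr (w-2) n) =O[atTop] (fun n : ℕ => (n:ℝ)^(w-3)) := by
  have h1 : (fun n : ℕ => (n:ℝ)^(w-3)) =O[atTop] (fun n : ℕ => (n:ℝ)^(w-2)) := by
    refine IsBigO.of_bound 1 ?_
    filter_upwards [eventually_ge_atTop 1] with n hn
    have hn0 : (1:ℝ) ≤ n := by exact_mod_cast hn
    rw [Real.norm_of_nonneg (by positivity), Real.norm_of_nonneg (by positivity), one_mul]
    exact Real.rpow_le_rpow_of_exponent_le hn0 (by linarith)
  have h2 : (fun n : ℕ => cr (w-1) n) =O[atTop] (fun n : ℕ => (n:ℝ)^(w-2)) := by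
    have := ((asym2 w hw hw1).trans h1).add ((isBigO_refl (fun n : ℕ => (n:ℝ)^(w-2)) atTop).const_mul_left ((w-1)/Real.Gamma w))
    exact this.congr_left (fun n => by ring)
  have h := (h2.mul (inv_shift (w-2))).const_mul_left (w-2)
  refine h.congr' ?_ ?_
  · filter_upwards [eventually_ge_atTop 3] with n hn
    have hn0 : (3:ℝ) ≤ n := by exact_mod_cast hn
    have hp : 0 < w - 2 + n := by linarith
    have := cr_shift (w-1) n
    rw [show w - 1 - 1 = w - 2 by ring] at this
    field_simp
    linarith
  · filter_upwards [eventually_ge_atTop 1] with n hn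
    rw [pow2 w n hn, pow1 w n hn]; ring

lemma asym3' (w : ℝ) (hw : 0 < w) (hw1 : w < 1) :
    ∃ C, 0 < C ∧ ∀ n : ℕ, |cr (w-2) n| ≤ C * ((n:ℝ)+1)^(w-3) := by
  have h1 : (fun n : ℕ => (n:ℝ)^(w-3)) =O[atTop] (fun n : ℕ => ((n:ℝ)+1)^(w-3)) := by
    refine IsBigO.of_bound ((2:ℝ)^(3-w)) ?_
    filter_upwards [eventually_ge_atTop 1] with n hn
    have hn0 : (1:ℝ) ≤ n := by exact_mod_cast hn
    rw [Real.norm_of_nonneg (by positivity), Real.norm_of_nonneg (by positivity)]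
    have h2 : (2 * (n:ℝ))^(w-3) ≤ ((n:ℝ)+1)^(w-3) :=
      Real.rpow_le_rpow_of_nonpos (by positivity) (by linarith) (by linarith)
    rw [Real.mul_rpow (by norm_num) (by positivity)] at h2
    calc (n:ℝ)^(w-3) = (2:ℝ)^(3-w) * (2^(w-3) * (n:ℝ)^(w-3)) := by
          rw [← mul_assoc, ← Real.rpow_add (by norm_num)]; simp
      _ ≤ _ := by gcongr
  obtain ⟨C, hC, h⟩ := bound_of_isBigO_nat_atTop ((asym3 w hw hw1).trans h1)
  refine ⟨C, hC, fun n => ?_⟩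
  have hp : 0 < ((n:ℝ)+1)^(w-3) := by positivity
  have := h (x := n) hp.ne'
  rwa [Real.norm_of_nonneg hp.le] at this

lemma conv_bound (p C : ℝ) (hp0 : p ≤ 0) (hp3 : -3 ≤ p) (hC : 0 < C) (κ c : ℕ → ℂ)
    (hκ : Summable (fun k : ℕ => ‖κ k‖ * ((k:ℝ)+1)^3)) (hc : ∀ n : ℕ, ‖c n‖ ≤ C * ((n:ℝ)+1)^p) :
    ∀ n : ℕ, ‖∑ k ∈ Finset.range (n+1), κ k * c (n-k)‖ ≤ (C * ∑' k : ℕ, ‖κ k‖ * ((k:ℝ)+1)^3) * ((n:ℝ)+1)^p := by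
  intro n
  have h1 : ∀ k ∈ Finset.range (n+1), ‖κ k * c (n-k)‖ ≤ (C * ((n:ℝ)+1)^p) * (‖κ k‖ * ((k:ℝ)+1)^3) := by
    intro k hk
    have hk : k ≤ n := by simp at hk; omega
    obtain ⟨m, rfl⟩ := Nat.exists_eq_add_of_le hk
    rw [norm_mul, Nat.add_sub_cancel_left]
    have h2 : ((m:ℝ)+1)^p ≤ ((k+m:ℕ)+1:ℝ)^p * ((k:ℝ)+1)^3 := by
      have h3 : (((m:ℝ)+1) * ((k:ℝ)+1))^p ≤ ((k+m:ℕ)+1:ℝ)^p :=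
        Real.rpow_le_rpow_of_nonpos (by positivity) (by push_cast; nlinarith [(Nat.cast_nonneg m : (0:ℝ) ≤ m), (Nat.cast_nonneg k : (0:ℝ) ≤ k), mul_nonneg (Nat.cast_nonneg m : (0:ℝ) ≤ m) (Nat.cast_nonneg k : (0:ℝ) ≤ k)]) hp0
      rw [Real.mul_rpow (by positivity) (by positivity)] at h3
      have h4 : ((k:ℝ)+1)^p * ((k:ℝ)+1)^3 ≥ 1 := by
        rw [← Real.rpow_natCast, ← Real.rpow_add (by positivity)]
        exact Real.one_le_rpow (by linarith [(Nat.cast_nonneg k : (0:ℝ) ≤ k)]) (by push_cast; linarith)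
      calc ((m:ℝ)+1)^p ≤ ((m:ℝ)+1)^p * (((k:ℝ)+1)^p * ((k:ℝ)+1)^3) := le_mul_of_one_le_right (by positivity) h4
        _ = ((m:ℝ)+1)^p * ((k:ℝ)+1)^p * ((k:ℝ)+1)^3 := by ring
        _ ≤ _ := by gcongr
    calc ‖κ k‖ * ‖c m‖ ≤ ‖κ k‖ * (C * (((k+m:ℕ)+1:ℝ)^p * ((k:ℝ)+1)^3)) := by
          gcongr; exact (hc m).trans (by gcongr)
      _ = _ := by ring
  calc _ ≤ ∑ k ∈ Finset.range (n+1), ‖κ k * c (n-k)‖ := norm_sum_le _ _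
    _ ≤ ∑ k ∈ Finset.range (n+1), (C * ((n:ℝ)+1)^p) * (‖κ k‖ * ((k:ℝ)+1)^3) := Finset.sum_le_sum h1
    _ = (C * ((n:ℝ)+1)^p) * ∑ k ∈ Finset.range (n+1), (‖κ k‖ * ((k:ℝ)+1)^3) := by rw [Finset.mul_sum]
    _ ≤ (C * ((n:ℝ)+1)^p) * ∑' k : ℕ, ‖κ k‖ * ((k:ℝ)+1)^3 := by
      gcongr; exact hκ.sum_le_tsum _ (fun i _ => by positivity)
    _ = _ := by ring

lemma series_exists (R : ℝ) (hR : 1 < R) (K : ℂ → ℂ) (hK : DifferentiableOn ℂ K (Metric.ball 0 R)) :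
    ∃ κ : ℕ → ℂ, Summable (fun k : ℕ => ‖κ k‖ * ((k:ℝ)+1)^3) ∧
      ∀ x : ℂ, ‖x‖ < 1 → HasSum (fun n => κ n * x^n) (K x) := by
  have hs : ∀ x : ℂ, ‖x‖ < R → HasSum (fun n : ℕ => ((n.factorial : ℂ)⁻¹ * iteratedDeriv n K 0) * x^n) (K x) := by
    intro x hx
    have := Complex.hasSum_taylorSeries_on_ball hK (z := x) (by simpa using hx)
    refine this.congr_fun fun n => ?_
    simp; ring
  refine ⟨_, ?_, fun x hx => hs x (hx.trans hR)⟩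
  set κ := fun n : ℕ => ((n.factorial : ℂ)⁻¹ * iteratedDeriv n K 0)
  obtain ⟨t, ht1, htR⟩ := exists_between hR
  have ht0 : 0 < t := by linarith
  have hb := (hs (t:ℂ) (by rw [Complex.norm_real, Real.norm_of_nonneg ht0.le]; exact htR)).summable.tendsto_atTop_zero
  obtain ⟨M, hM⟩ := (Metric.isBounded_range_of_tendsto _ hb).exists_norm_le
  have hM' : ∀ n, ‖κ n‖ * t^n ≤ M := by
    intro n
    have := hM _ ⟨n, rfl⟩
    rwa [norm_mul, norm_pow, Complex.norm_real, Real.norm_of_nonneg ht0.le] at this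
  have hsum : Summable (fun n : ℕ => ((n:ℝ))^3 * (t⁻¹)^n) :=
    summable_pow_mul_geometric_of_norm_lt_one 3 (by
      rw [norm_inv, Real.norm_of_nonneg ht0.le]; exact inv_lt_one_of_one_lt₀ ht1)
  have hsum2 := ((summable_nat_add_iff 1).2 hsum).mul_left (M * t)
  refine Summable.of_nonneg_of_le (fun k => by positivity) (fun k => ?_) hsum2
  have : ‖κ k‖ ≤ M * (t⁻¹)^k := by
    rw [inv_pow, ← div_eq_mul_inv, le_div_iff₀ (by positivity)]; exact hM' k
  calc ‖κ k‖ * ((k:ℝ)+1)^3 ≤ M * (t⁻¹)^k * ((k:ℝ)+1)^3 := by gcongr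
    _ = _ := by push_cast; rw [pow_succ (t⁻¹)]; field_simp

lemma series_ball (B : ℕ → ℂ) (F : ℂ → ℂ) (h : ∀ x : ℂ, ‖x‖ < 1 → HasSum (fun n => B n * x^n) (F x)) :
    HasFPowerSeriesOnBall F (FormalMultilinearSeries.ofScalars ℂ B) 0 1 where
  r_le := by
    refine ENNReal.le_of_forall_nnreal_lt fun r hr => ?_
    have hr1 : (r:ℝ) < 1 := by exact_mod_cast hr
    have := (h (r:ℝ) (by simpa using hr1)).summable.tendsto_atTop_zero.norm
    refine FormalMultilinearSeries.le_radius_of_tendsto _ (l := ‖(0:ℂ)‖) ?_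
    refine this.congr (fun n => ?_)
    simp
  r_pos := one_pos
  hasSum := by
    intro y hy
    have hy : ‖y‖ < 1 := by
      simpa [← ofReal_norm] using hy
    simpa [FormalMultilinearSeries.ofScalars_apply_eq, mul_comm] using h y hy

lemma series_unique (B D : ℕ → ℂ) (F : ℂ → ℂ) (h : ∀ x : ℂ, ‖x‖ < 1 → HasSum (fun n => B n * x^n) (F x))
    (h' : ∀ x : ℂ, ‖x‖ < 1 → HasSum (fun n => D n * x^n) (F x)) (n : ℕ) : B n = D n := by
  have := (series_ball B F h).hasFPowerSeriesAt.eq_formalMultilinearSeries (series_ball D F h').hasFPowerSeriesAt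
  have := congrArg (fun p => FormalMultilinearSeries.coeff p n) this
  simpa [FormalMultilinearSeries.coeff_ofScalars] using this

lemma series_norm (B : ℕ → ℂ) (F : ℂ → ℂ) (h : ∀ x : ℂ, ‖x‖ < 1 → HasSum (fun n => B n * x^n) (F x))
    (x : ℂ) (hx : ‖x‖ < 1) : Summable (fun n => ‖B n * x^n‖) := by
  have := (FormalMultilinearSeries.ofScalars ℂ B).summable_norm_apply (x := x)
    (Metric.eball_subset_eball (series_ball B F h).r_le (by simpa [← ofReal_norm] using hx))
  simpa [FormalMultilinearSeries.ofScalars_apply_eq, mul_comm] using this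

lemma series_mul (B D : ℕ → ℂ) (F G : ℂ → ℂ) (h : ∀ x : ℂ, ‖x‖ < 1 → HasSum (fun n => B n * x^n) (F x))
    (h' : ∀ x : ℂ, ‖x‖ < 1 → HasSum (fun n => D n * x^n) (G x)) (x : ℂ) (hx : ‖x‖ < 1) :
    HasSum (fun n => (∑ k ∈ Finset.range (n+1), B k * D (n-k)) * x^n) (F x * G x) := by
  have := hasSum_sum_range_mul_of_summable_norm (series_norm B F h x hx) (series_norm D G h' x hx)
  rw [(h x hx).tsum_eq, (h' x hx).tsum_eq] at this
  refine this.congr_fun fun n => ?_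
  rw [Finset.sum_mul]
  refine Finset.sum_congr rfl (fun k hk => ?_)
  have hk : k ≤ n := by simp at hk; omega
  have : x^n = x^k * x^(n-k) := by rw [← pow_add]; congr 1; omega
  rw [this]; ring

lemma cc_series (s : ℂ) (x : ℂ) (hx : ‖x‖ < 1) : HasSum (fun n => cc s n * x^n) ((1 - x)^(-s)) := by
  have := (Complex.one_div_one_sub_cpow_hasFPowerSeriesOnBall_zero s).hasSum (y := x) (by simpa [← ofReal_norm] using hx)
  have hc : ∀ n : ℕ, Ring.choose (s + n - 1) n = cc s n := by
    intro n
    have h1 : cc s n * n.factorial = (ascPochhammer ℂ n).eval s := by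
      induction n with
      | zero => simp [cc]
      | succ n ih =>
        rw [ascPochhammer_succ_eval, ← ih, cc, cc, Finset.prod_range_succ, Nat.factorial_succ]
        have : (n:ℂ) + 1 ≠ 0 := by exact_mod_cast n.succ_ne_zero
        push_cast
        field_simp
    have hf : (n.factorial : ℂ) ≠ 0 := by exact_mod_cast n.factorial_ne_zero
    rw [Ring.choose_eq_smul, Polynomial.descPochhammer_smeval_eq_ascPochhammer,
      Polynomial.ascPochhammer_smeval_cast, Polynomial.ascPochhammer_smeval_eq_eval,
      show s + n - 1 - n + 1 = s by ring, ← h1]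
    simp
    field_simp
  simp only [FormalMultilinearSeries.ofScalars_apply_eq, hc, zero_add, smul_eq_mul] at this
  rwa [one_div, ← Complex.cpow_neg] at this

lemma norm_case (w R : ℝ) (hw0 : 0 < w) (hw1 : w < 1) (hR : 1 < R) (B : ℕ → ℂ) (F G H : ℂ → ℂ)
    (hF : ∀ x : ℂ, ‖x‖ < 1 → HasSum (fun n => B n * x^n) (F x))
    (hG : DifferentiableOn ℂ G (Metric.ball 0 R)) (hH : DifferentiableOn ℂ H (Metric.ball 0 R))
    (heq : ∀ x : ℂ, ‖x‖ < 1 → F x = G x * (1 - x)^(-(w:ℂ)) + H x) :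
    (fun n : ℕ => B n - G 1 * ((1 / Real.Gamma w * (n:ℝ)^(w-1) : ℝ) : ℂ)
      - ((w-1)/2 * w * G 1 - (w-1) * deriv G 1) * ((1 / Real.Gamma w * (n:ℝ)^(w-2) : ℝ) : ℂ))
      =O[atTop] (fun n : ℕ => (n:ℝ)^(w-3)) := by
  have hnhds : Metric.ball (0:ℂ) R ∈ 𝓝 (1:ℂ) := Metric.isOpen_ball.mem_nhds (by simpa using hR)
  obtain ⟨κ, hκs, hκ⟩ := series_exists R hR (dslope (dslope G 1) 1)
    ((Complex.differentiableOn_dslope hnhds).2 ((Complex.differentiableOn_dslope hnhds).2 hG))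
  obtain ⟨η, hηs, hη⟩ := series_exists R hR H hH
  obtain ⟨C, hC, hcb⟩ := asym3' w hw0 hw1
  have hB : ∀ n, B n = G 1 * cc w n - deriv G 1 * cc ((w-1:ℝ):ℂ) n
      + ∑ k ∈ Finset.range (n+1), κ k * cc ((w-2:ℝ):ℂ) (n-k) + η n := by
    refine series_unique B _ F hF fun x hx => ?_
    have h1 := (cc_series (w:ℂ) x hx).mul_left (G 1)
    have h2 := (cc_series ((w-1:ℝ):ℂ) x hx).mul_left (deriv G 1)
    have h3 := series_mul κ (cc ((w-2:ℝ):ℂ)) _ (fun x => (1-x)^(-((w-2:ℝ):ℂ))) hκ (cc_series _) x hx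
    have h := ((h1.sub h2).add h3).add (hη x hx)
    have hx1 : (1:ℂ) - x ≠ 0 := by
      intro h0
      have : x = 1 := by linear_combination -h0
      rw [this] at hx; simp at hx
    have e1 : (1-x)^(-((w-1:ℝ):ℂ)) = (1-x)^(-(w:ℂ)) * (1-x) := by
      rw [show (-((w-1:ℝ):ℂ)) = -(w:ℂ) + 1 by push_cast; ring, Complex.cpow_add _ _ hx1, Complex.cpow_one]
    have e2 : (1-x)^(-((w-2:ℝ):ℂ)) = (1-x)^(-(w:ℂ)) * (1-x) * (1-x) := by
      rw [show (-((w-2:ℝ):ℂ)) = -(w:ℂ) + 1 + 1 by push_cast; ring, Complex.cpow_add _ _ hx1, Complex.cpow_add _ _ hx1, Complex.cpow_one]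
    have d1 := sub_smul_dslope G 1 x
    have d2 := sub_smul_dslope (dslope G 1) 1 x
    rw [dslope_same] at d2
    simp only [smul_eq_mul] at d1 d2
    have hsum : F x = G 1 * (1-x)^(-(w:ℂ)) - deriv G 1 * (1-x)^(-((w-1:ℝ):ℂ))
        + dslope (dslope G 1) 1 x * (1-x)^(-((w-2:ℝ):ℂ)) + H x := by
      rw [heq x hx, e1, e2]
      linear_combination (-(1-x)^(-(w:ℂ))) * d1 + (1-x)^(-(w:ℂ)) * (1-x) * d2
    rw [hsum]
    refine h.congr_fun fun n => ?_
    ring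
  have hmono : (fun n : ℕ => ((n:ℝ)+1)^(w-3)) =O[atTop] (fun n : ℕ => (n:ℝ)^(w-3)) := by
    refine IsBigO.of_bound 1 ?_
    filter_upwards [eventually_ge_atTop 1] with n hn
    have hn0 : (1:ℝ) ≤ n := by exact_mod_cast hn
    rw [Real.norm_of_nonneg (by positivity), Real.norm_of_nonneg (by positivity), one_mul]
    exact Real.rpow_le_rpow_of_nonpos (by positivity) (by linarith) (by linarith)
  have o3 : (fun n : ℕ => ∑ k ∈ Finset.range (n+1), κ k * cc ((w-2:ℝ):ℂ) (n-k)) =O[atTop] (fun n : ℕ => (n:ℝ)^(w-3)) := by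
    refine IsBigO.trans (IsBigO.of_bound (C * ∑' k : ℕ, ‖κ k‖ * ((k:ℝ)+1)^3) (Eventually.of_forall fun n => ?_)) hmono
    have := conv_bound (w-3) C (by linarith) (by linarith) hC κ (cc ((w-2:ℝ):ℂ)) hκs (fun n => by
      rw [cc_ofReal, Complex.norm_real]; exact hcb n) n
    rwa [Real.norm_of_nonneg (by positivity)]
  have o4 : η =O[atTop] (fun n : ℕ => (n:ℝ)^(w-3)) := by
    refine IsBigO.trans (IsBigO.of_bound (∑' k : ℕ, ‖η k‖ * ((k:ℝ)+1)^3) (Eventually.of_forall fun n => ?_)) hmono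
    rw [Real.norm_of_nonneg (by positivity)]
    have h1 := hηs.le_tsum n (fun i _ => by positivity)
    have h2 : 1 ≤ ((n:ℝ)+1)^3 * ((n:ℝ)+1)^(w-3) := by
      rw [← Real.rpow_natCast, ← Real.rpow_add (by positivity)]
      exact Real.one_le_rpow (by linarith [(Nat.cast_nonneg n : (0:ℝ) ≤ n)]) (by push_cast; linarith)
    calc ‖η n‖ ≤ ‖η n‖ * (((n:ℝ)+1)^3 * ((n:ℝ)+1)^(w-3)) := le_mul_of_one_le_right (norm_nonneg _) h2
      _ = ‖η n‖ * ((n:ℝ)+1)^3 * ((n:ℝ)+1)^(w-3) := by ring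
      _ ≤ _ := by gcongr
  have o1 := (Complex.isBigO_ofReal_left.2 (asym1 w hw0 hw1)).const_mul_left (G 1)
  have o2 := (Complex.isBigO_ofReal_left.2 (asym2 w hw0 hw1)).const_mul_left (deriv G 1)
  refine (((o1.sub o2).add o3).add o4).congr_left fun n => ?_
  rw [hB n, cc_ofReal, cc_ofReal]
  push_cast
  ring

theorem stmt7 (q a w ρ : ℝ) (hq : 2 ≤ q) (ha : 0 < a) (hw0 : 0 < w) (hw1 : w < 1)
    (hρ : q ^ (-a) < ρ)
    (A : ℕ → ℂ) (f g h : ℂ → ℂ)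
    (hf : ∀ u : ℂ, ‖u‖ < q ^ (-a) → HasSum (fun n : ℕ => A n * u ^ n) (f u))
    (hg : ∀ u : ℂ, ‖u‖ < ρ → DifferentiableAt ℂ g u)
    (hh : ∀ u : ℂ, ‖u‖ < ρ → DifferentiableAt ℂ h u)
    (heq : ∀ u : ℂ, ‖u‖ < q ^ (-a) →
      f u = g u * (((q ^ (-a) : ℝ) : ℂ) - u) ^ (-(w : ℂ)) + h u) :
    (fun n : ℕ => A n -
        g ((q ^ (-a) : ℝ) : ℂ) * ((q ^ (a * w) / Real.Gamma w : ℝ) : ℂ) *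
          ((q ^ (a * (n : ℝ)) * (n : ℝ) ^ (w - 1) : ℝ) : ℂ) -
        ((q ^ (a * w) / Real.Gamma (w - 1) : ℝ) : ℂ) *
            (((w : ℂ) / 2) * g ((q ^ (-a) : ℝ) : ℂ) -
              ((q ^ (-a) : ℝ) : ℂ) * deriv g ((q ^ (-a) : ℝ) : ℂ)) *
          ((q ^ (a * (n : ℝ)) * (n : ℝ) ^ (w - 2) : ℝ) : ℂ))
      =O[atTop] (fun n : ℕ => q ^ (a * (n : ℝ)) * (n : ℝ) ^ (w - 3)) := by
  have hq0 : 0 < q := by linarith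
  have hr0 : 0 < q ^ (-a) := by positivity
  have hqw : q ^ (a * w) = (q ^ (-a)) ^ (-w) := by rw [← Real.rpow_mul hq0.le]; congr 1; ring
  have hqn : ∀ n : ℕ, q ^ (a * (n:ℝ)) = ((q ^ (-a)) ^ n)⁻¹ := by
    intro n
    rw [← Real.rpow_natCast, ← Real.rpow_mul hq0.le, ← Real.rpow_neg hq0.le]; congr 1; ring
  have hGam : Real.Gamma w = (w-1) * Real.Gamma (w-1) := by
    have := Real.Gamma_add_one (s := w-1) (by linarith)
    rwa [sub_add_cancel] at this
  have hGp := Real.Gamma_pos_of_pos hw0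
  have hGinv : 1 / Real.Gamma (w-1) = (w-1) / Real.Gamma w := by
    have h2 : w - 1 ≠ 0 := by linarith
    have : Real.Gamma (w-1) ≠ 0 := by
      intro h0; rw [h0, mul_zero] at hGam; exact hGp.ne' hGam
    rw [hGam]; field_simp
  rw [hqw]
  simp only [hqn]
  set r := q ^ (-a) with hr
  have hrn : ∀ x : ℂ, ‖(r:ℂ) * x‖ = r * ‖x‖ := by
    intro x; rw [norm_mul, Complex.norm_real, Real.norm_of_nonneg hr0.le]
  have hball : ∀ x ∈ Metric.ball (0:ℂ) (ρ / r), ‖(r:ℂ) * x‖ < ρ := by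
    intro x hx
    rw [mem_ball_zero_iff, lt_div_iff₀ hr0] at hx
    rw [hrn]; linarith
  have hin : ∀ x : ℂ, ‖x‖ < 1 → ‖(r:ℂ) * x‖ < r := by
    intro x hx; rw [hrn]; nlinarith
  have hd : ∀ x : ℂ, HasDerivAt (fun x : ℂ => (r:ℂ) * x) r x := fun x => by
    simpa using (hasDerivAt_id x).const_mul (r:ℂ)
  set G : ℂ → ℂ := fun x => g (r * x) * ((r ^ (-w) : ℝ) : ℂ) with hGdef
  have key := norm_case w (ρ / r) hw0 hw1 (by rw [lt_div_iff₀ hr0]; linarith) (fun n => A n * (r:ℂ)^n)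
    (fun x => f (r * x)) G (fun x => h (r * x))
    (fun x hx => by
      refine (hf _ (hin x hx)).congr_fun fun n => ?_
      rw [mul_pow]; ring)
    (fun x hx => (((hg _ (hball x hx)).hasDerivAt.comp x (hd x)).differentiableAt.mul_const _).differentiableWithinAt)
    (fun x hx => ((hh _ (hball x hx)).hasDerivAt.comp x (hd x)).differentiableAt.differentiableWithinAt)
    (fun x hx => by
      have hx1 : (1:ℂ) - x ≠ 0 := by
        intro h0
        have : x = 1 := by linear_combination -h0
        rw [this] at hx; simp at hx
      have hrc : (r:ℂ) ≠ 0 := by exact_mod_cast hr0.ne'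
      have e : ((r:ℂ) - r * x) ^ (-(w:ℂ)) = ((r ^ (-w) : ℝ) : ℂ) * (1 - x) ^ (-(w:ℂ)) := by
        rw [show (r:ℂ) - r * x = r * (1 - x) by ring, Complex.ofReal_cpow hr0.le,
          Complex.cpow_def_of_ne_zero (mul_ne_zero hrc hx1), Complex.cpow_def_of_ne_zero hrc,
          Complex.cpow_def_of_ne_zero hx1, Complex.log_ofReal_mul hr0 hx1, ← Complex.exp_add,
          Complex.ofReal_log hr0.le]
        congr 1; push_cast; ring
      simp only [hGdef]
      rw [heq _ (hin x hx), e]; ring)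
  have hG1 : G 1 = g r * ((r ^ (-w) : ℝ) : ℂ) := by simp [hGdef]
  have hG' : deriv G 1 = deriv g r * r * ((r ^ (-w) : ℝ) : ℂ) := by
    have h1 : DifferentiableAt ℂ g ((r:ℂ) * 1) := hg _ (by rw [hrn]; simpa using hρ)
    have := ((h1.hasDerivAt.comp 1 (hd 1)).mul_const ((r ^ (-w) : ℝ) : ℂ)).deriv
    rw [mul_one] at this
    exact this
  have fin := (Complex.isBigO_ofReal_left.2 (isBigO_refl (fun n : ℕ => ((r^n)⁻¹ : ℝ)) atTop)).mul key
  refine fin.congr_left fun n => ?_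
  rw [hG1, hG']
  have hrc : ((r:ℂ)^n) ≠ 0 := pow_ne_zero _ (by exact_mod_cast hr0.ne')
  have hA : A n = ((r:ℂ)^n)⁻¹ * (A n * (r:ℂ)^n) := by field_simp
  rw [div_eq_mul_one_div _ (Real.Gamma (w-1)), hGinv]
  conv_rhs => rw [hA]
  push_cast
  ring
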